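/- arXiv:2408.16948 — 5 statements merged into one kernel-verified Lean document; each statement's English description precedes it below -/
import Mathlib

section
/- Let T be a finite tree with at least two edges, let v₀ be a leaf of T with unique neighbor v₁, and let T' be the induced subgraph of T on the vertex set obtained by deleting v₀. Then T' is a tree, and, writing n(S) = 3·n₁(S) + 2·n₂(S) + #{v : deg_S(v) ≥ 3 and deg_S(v) is odd} for a finite tree S, we have n(T) = n(T') + 2 if the degree of v₁ in T' equals 2 or is odd, and n(T) = n(T') + 4 otherwise; in particular n(T) ≥ n(T') + 2. -/
open Finset
open scoped Classical

/-- The degree of a vertex in a (finite) simple graph. -/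
noncomputable def dgr {V : Type*} [Fintype V] (G : SimpleGraph V) (v : V) : ℕ :=
  (univ.filter fun w => G.Adj v w).card

/-- `n(S) = 3·n₁(S) + 2·n₂(S) + #{v : deg v ≥ 3 and odd}`. -/
noncomputable def nval {V : Type*} [Fintype V] (G : SimpleGraph V) : ℕ :=
  3 * (univ.filter fun v => dgr G v = 1).card
    + 2 * (univ.filter fun v => dgr G v = 2).card
    + (univ.filter fun v => 3 ≤ dgr G v ∧ Odd (dgr G v)).card

theorem dgr_eq_sum {V : Type*} [Fintype V] (G : SimpleGraph V) (v : V) :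
    dgr G v = ∑ w, if G.Adj v w then 1 else 0 := by
  rw [dgr, card_filter]

/-- The contribution of a vertex of degree `d` to `nval`. -/
noncomputable def vertexWeight (d : ℕ) : ℕ :=
  if d = 1 then 3 else if d = 2 then 2 else if Odd d then 1 else 0

theorem nval_eq_sum_vertexWeight {V : Type*} [Fintype V] (G : SimpleGraph V) :
    nval G = ∑ v, vertexWeight (dgr G v) := by
  simp only [nval, card_filter, mul_sum, ← sum_add_distrib]
  refine sum_congr rfl fun v _ => ?_
  simp only [vertexWeight]
  split_ifs <;> grind

theorem dgr_eq_dgr_induce_add {V : Type*} [Fintype V] (G : SimpleGraph V) (v₀ : V)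
    (v : {v | v ≠ v₀}) :
    dgr G v = dgr (G.induce {v | v ≠ v₀}) v + if G.Adj v v₀ then 1 else 0 := by
  rw [dgr_eq_sum, dgr_eq_sum, Fintype.sum_eq_add_sum_subtype_ne _ v₀, add_comm]
  congr 1

theorem nval_eq_add_sum_ne {V : Type*} [Fintype V] (G : SimpleGraph V) (v₀ : V) :
    nval G = vertexWeight (dgr G v₀) + ∑ v : {v | v ≠ v₀}, vertexWeight (dgr G v) := by
  rw [nval_eq_sum_vertexWeight, Fintype.sum_eq_add_sum_subtype_ne _ v₀]
  congr 1

theorem eq_of_adj_of_dgr_eq_one {V : Type*} [Fintype V] {G : SimpleGraph V} {v w u : V}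
    (h : dgr G v = 1) (hw : G.Adj v w) (hu : G.Adj v u) : u = w :=
  card_le_one.mp h.le u (by simpa) w (by simpa)

theorem SimpleGraph.IsTree.induce_ne_of_dgr_eq_one {V : Type*} [Fintype V] {G : SimpleGraph V}
    (hT : G.IsTree) {v₀ : V} (h : dgr G v₀ = 1) : (G.induce {v | v ≠ v₀}).IsTree := by
  refine ⟨?_, hT.isAcyclic.induce _⟩
  refine hT.connected.induce_compl_singleton_of_degree_eq_one (v := v₀) ?_
  rw [← h, dgr, ← SimpleGraph.card_neighborFinset_eq_degree]
  congr 1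
  ext
  simp

theorem nval_add_vertexWeight_of_dgr_eq_one {V : Type*} [Fintype V] {G : SimpleGraph V}
    {v₀ v₁ : V} (hleaf : dgr G v₀ = 1) (hadj : G.Adj v₀ v₁) :
    nval G + vertexWeight (dgr (G.induce {v | v ≠ v₀}) ⟨v₁, hadj.ne'⟩) =
      nval (G.induce {v | v ≠ v₀}) + 3 +
        vertexWeight (dgr (G.induce {v | v ≠ v₀}) ⟨v₁, hadj.ne'⟩ + 1) := by
  have hv₁ := dgr_eq_dgr_induce_add G v₀ ⟨v₁, hadj.ne'⟩
  rw [if_pos hadj.symm] at hv₁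
  have hrest : ∀ v ∈ univ.erase (⟨v₁, hadj.ne'⟩ : {v | v ≠ v₀}),
      vertexWeight (dgr G v) = vertexWeight (dgr (G.induce {v | v ≠ v₀}) v) := by
    intro v hv
    rw [dgr_eq_dgr_induce_add G v₀ v, if_neg, add_zero]
    exact fun h => ne_of_mem_erase hv (Subtype.ext (eq_of_adj_of_dgr_eq_one hleaf hadj h.symm))
  have hG := add_sum_erase univ (fun v : {v | v ≠ v₀} => vertexWeight (dgr G v))
    (mem_univ ⟨v₁, hadj.ne'⟩)
  have hG' := add_sum_erase univ (fun v => vertexWeight (dgr (G.induce {v | v ≠ v₀}) v))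
    (mem_univ ⟨v₁, hadj.ne'⟩)
  rw [sum_congr rfl hrest, hv₁] at hG
  rw [nval_eq_add_sum_ne G v₀, nval_eq_sum_vertexWeight (G.induce _), ← hG, ← hG', hleaf,
    show vertexWeight 1 = 3 by simp [vertexWeight]]
  ring

theorem dgr_pos_of_preconnected {V : Type*} [Fintype V] [Nontrivial V] {G : SimpleGraph V}
    (h : G.Preconnected) (v : V) : 0 < dgr G v := by
  obtain ⟨w, hw⟩ := h.exists_adj_of_nontrivial v
  exact card_pos.mpr ⟨w, by simpa⟩

theorem SimpleGraph.IsTree.nontrivial_ne_of_two_le_ncard_edgeSet {V : Type*} [Fintype V]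
    {G : SimpleGraph V} (hT : G.IsTree) (h2 : 2 ≤ G.edgeSet.ncard) (v₀ : V) :
    Nontrivial {v | v ≠ v₀} := by
  have hcard := hT.card_edgeFinset
  rw [← Set.ncard_coe_finset, SimpleGraph.coe_edgeFinset] at hcard
  rw [← Fintype.one_lt_card_iff_nontrivial]
  have : Fintype.card {v // v ≠ v₀} = Fintype.card V - 1 := by
    simp
  change 1 < Fintype.card {v // v ≠ v₀}
  omega

/-- Deleting a leaf `v₀` (with unique neighbor `v₁`) from a finite tree `T`
with at least two edges yields a tree `T'` with `n(T) = n(T') + 2` if the degree of `v₁` in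
`T'` equals `2` or is odd, and `n(T) = n(T') + 4` otherwise; in particular
`n(T) ≥ n(T') + 2`. -/
theorem nval_delete_leaf {V : Type*} [Fintype V] (G : SimpleGraph V)
    (hT : G.IsTree) (h2 : 2 ≤ G.edgeSet.ncard)
    (v₀ v₁ : V) (hleaf : dgr G v₀ = 1) (hadj : G.Adj v₀ v₁) :
    (G.induce {v | v ≠ v₀}).IsTree ∧
      ((dgr (G.induce {v | v ≠ v₀}) ⟨v₁, hadj.ne'⟩ = 2 ∨
          Odd (dgr (G.induce {v | v ≠ v₀}) ⟨v₁, hadj.ne'⟩)) →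
        nval G = nval (G.induce {v | v ≠ v₀}) + 2) ∧
      (¬ (dgr (G.induce {v | v ≠ v₀}) ⟨v₁, hadj.ne'⟩ = 2 ∨
          Odd (dgr (G.induce {v | v ≠ v₀}) ⟨v₁, hadj.ne'⟩)) →
        nval G = nval (G.induce {v | v ≠ v₀}) + 4) ∧
      nval (G.induce {v | v ≠ v₀}) + 2 ≤ nval G := by
  have hT' := hT.induce_ne_of_dgr_eq_one hleaf
  have := hT.nontrivial_ne_of_two_le_ncard_edgeSet h2 v₀
  have hpos := dgr_pos_of_preconnected hT'.connected.preconnected ⟨v₁, hadj.ne'⟩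
  have hval := nval_add_vertexWeight_of_dgr_eq_one hleaf hadj
  refine ⟨hT', ?_⟩
  generalize dgr (G.induce {v | v ≠ v₀}) ⟨v₁, hadj.ne'⟩ = d at hpos hval ⊢
  simp only [vertexWeight] at hval
  grind
end

section
/- Let a finite loopless multigraph be given by finite types E (edges) and V (vertices) together with maps s, t : E → V satisfying s(e) ≠ t(e) for every e (an arbitrary orientation of the edges), and call f : E → ℤ a circulation if for every vertex v, Σ_{e : s(e) = v} f(e) = Σ_{e : t(e) = v} f(e). If some circulation is not identically zero, then the minimum of Σ_{e ∈ E} f(e)² over all nonzero circulations f equals the minimum of the support size #{e : f(e) ≠ 0} over all nonzero circulations f. -/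
open Finset
open scoped Classical

/-- A circulation on a finite multigraph given by edge-endpoint maps `s t : E → V`:
an integer-valued function on edges satisfying the conservation law at every vertex. -/
def IsCirculation {E V : Type*} [Fintype E] (s t : E → V) (f : E → ℤ) : Prop :=
  ∀ v : V, (∑ e : E, if s e = v then f e else 0) = ∑ e : E, if t e = v then f e else 0

/-- A finite nonempty set mapped into itself contains a nonempty subset mapped onto itself. -/
theorem Finset.exists_nonempty_subset_image_eq {α : Type*} (n : α → α) (S : Finset α)
    (hS : S.Nonempty) (hn : S.image n ⊆ S) : ∃ O ⊆ S, O.Nonempty ∧ O.image n = O := by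
  induction S using Finset.strongInduction with
  | H S ih =>
    rcases hn.eq_or_ssubset with h | h
    · exact ⟨S, Subset.rfl, hS, h⟩
    · obtain ⟨O, hO, h'⟩ := ih _ h (hS.image n) (image_subset_image hn)
      exact ⟨O, hO.trans hn, h'⟩

/-- An edge of the support of a circulation is followed by another one, when every edge `e` is
directed so that `f e` becomes positive. -/
theorem IsCirculation.exists_next {E V : Type*} [Fintype E] {s t : E → V} {f : E → ℤ}
    (hf : IsCirculation s t f) {e : E} (he : f e ≠ 0) :
    ∃ e', f e' ≠ 0 ∧
      (if 0 < f e' then s e' else t e') = if 0 < f e then t e else s e := by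
  by_contra! hne
  set v := if 0 < f e then t e else s e with hv
  have hsum : ∑ e' : E, ((if t e' = v then f e' else 0) - if s e' = v then f e' else 0) = 0 := by
    rw [sum_sub_distrib, hf v, sub_self]
  have hpos : 0 < ∑ e' : E,
      ((if t e' = v then f e' else 0) - if s e' = v then f e' else 0) := by
    refine sum_pos' (fun i _ => ?_) ⟨e, mem_univ e, ?_⟩
    · have := hne i
      grind
    · have := hne e he
      grind
  exact hpos.ne' hsum

/-- The support of a nonzero circulation contains the support of a nonzero circulation with
values in `{-1, 0, 1}`. -/
theorem IsCirculation.exists_unit_circulation {E V : Type*} [Fintype E] {s t : E → V} {f : E → ℤ}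
    (hf : IsCirculation s t f) (hf0 : f ≠ 0) :
    ∃ g : E → ℤ, IsCirculation s t g ∧ g ≠ 0 ∧ (∀ e, g e ≠ 0 → f e ≠ 0) ∧
      ∀ e, g e = 0 ∨ g e = 1 ∨ g e = -1 := by
  have hnext : ∀ e, ∃ e', f e ≠ 0 → f e' ≠ 0 ∧
      (if 0 < f e' then s e' else t e') = if 0 < f e then t e else s e := by
    intro e
    by_cases he : f e = 0
    · exact ⟨e, fun h => absurd he h⟩
    · obtain ⟨e', h⟩ := hf.exists_next he
      exact ⟨e', fun _ => h⟩
  choose n hn using hnext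
  obtain ⟨e₀, he₀⟩ := Function.ne_iff.mp hf0
  obtain ⟨O, hO, ⟨e₁, he₁⟩, himg⟩ := Finset.exists_nonempty_subset_image_eq n
    (univ.filter fun e => f e ≠ 0) ⟨e₀, by simpa using he₀⟩
    (by
      intro x hx
      obtain ⟨y, hy, rfl⟩ := mem_image.mp hx
      simpa using (hn y (by simpa using hy)).1)
  have hO' : ∀ e ∈ O, f e ≠ 0 := fun e he => by simpa using hO he
  have hinj : Set.InjOn n O := card_image_iff.mp (by rw [himg])
  refine ⟨fun e => if e ∈ O then (if 0 < f e then 1 else -1) else 0, ?_, ?_, ?_, ?_⟩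
  · intro v
    have hshift : ∑ e ∈ O, (if (if 0 < f e then s e else t e) = v then (1 : ℤ) else 0) =
        ∑ e ∈ O, if (if 0 < f e then t e else s e) = v then (1 : ℤ) else 0 := by
      conv_lhs => rw [← himg, sum_image hinj]
      exact sum_congr rfl fun e he => by rw [(hn e (hO' e he)).2]
    rw [← sub_eq_zero, ← sum_sub_distrib] at hshift ⊢
    rw [← hshift, ← sum_filter_add_sum_filter_not univ (· ∈ O)]
    rw [filter_univ_mem, add_eq_left.mpr]
    · exact sum_congr rfl fun e he => by grind
    · exact sum_eq_zero fun e he => by simp_all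
  · intro h
    have := congrFun h e₁
    simp only [he₁, if_true, Pi.zero_apply] at this
    split_ifs at this
    simp at this
  · intro e he
    exact hO' e (by_contra fun h => he (if_neg h))
  · intro e
    dsimp only
    split_ifs <;> simp

/-- The support of an integer-valued function is at most as large as its sum of squares. -/
theorem card_support_le_sum_sq {E : Type*} [Fintype E] (f : E → ℤ) :
    ((univ.filter fun e => f e ≠ 0).card : ℤ) ≤ ∑ e : E, f e ^ 2 := by
  rw [card_filter, Nat.cast_sum]
  refine sum_le_sum fun e _ => ?_
  by_cases he : f e = 0
  · simp [he]
  · simpa [he] using Int.one_le_abs he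

/-- For a function with values in `{-1, 0, 1}` the sum of squares is the size of the support. -/
theorem sum_sq_eq_card_support {E : Type*} [Fintype E] {g : E → ℤ}
    (hg : ∀ e, g e = 0 ∨ g e = 1 ∨ g e = -1) :
    ∑ e : E, g e ^ 2 = ((univ.filter fun e => g e ≠ 0).card : ℤ) := by
  rw [card_filter, Nat.cast_sum]
  refine sum_congr rfl fun e _ => ?_
  rcases hg e with h | h | h <;> simp [h]

/-- In a finite loopless multigraph admitting a nonzero circulation, the
minimum of `∑ f(e)²` over nonzero circulations `f` equals the minimum of the support size
`#{e : f e ≠ 0}` over nonzero circulations `f`. -/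
theorem min_sq_sum_eq_min_support {E V : Type*} [Fintype E] [Fintype V]
    (s t : E → V) (hst : ∀ e, s e ≠ t e)
    (hex : ∃ f : E → ℤ, IsCirculation s t f ∧ f ≠ 0) :
    sInf {n : ℕ | ∃ f : E → ℤ, IsCirculation s t f ∧ f ≠ 0 ∧
        (∑ e : E, (f e) ^ 2) = (n : ℤ)} =
      sInf {n : ℕ | ∃ f : E → ℤ, IsCirculation s t f ∧ f ≠ 0 ∧
        (univ.filter fun e => f e ≠ 0).card = n} := by
  apply le_antisymm
  · obtain ⟨f₀, hf₀, hne₀⟩ := hex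
    refine le_csInf ⟨_, f₀, hf₀, hne₀, rfl⟩ ?_
    rintro _ ⟨f, hf, hne, rfl⟩
    obtain ⟨g, hg, hg0, hsub, hval⟩ := hf.exists_unit_circulation hne
    refine le_trans (Nat.sInf_le ?_) (card_le_card (monotone_filter_right univ fun e _ => hsub e))
    exact ⟨g, hg, hg0, sum_sq_eq_card_support hval⟩
  · obtain ⟨f₀, hf₀, hne₀⟩ := hex
    refine le_csInf ⟨(∑ e : E, f₀ e ^ 2).toNat, f₀, hf₀, hne₀, ?_⟩ ?_
    · exact (Int.toNat_of_nonneg (sum_nonneg fun e _ => sq_nonneg (f₀ e))).symm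
    rintro m ⟨f, hf, hne, hm⟩
    refine le_trans (Nat.sInf_le ?_)
      (show (univ.filter fun e => f e ≠ 0).card ≤ m from ?_)
    · exact ⟨f, hf, hne, rfl⟩
    exact_mod_cast hm ▸ card_support_le_sum_sq f
end

section
/- Let G be a simple graph on a finite vertex type V and let f : V → V → ℤ be a nonzero integer flow on G, i.e., f(u,v) = -f(v,u) for all u, v; f(u,v) = 0 whenever u and v are not adjacent in G; Σ_{v} f(u,v) = 0 for every vertex u; and f is not identically zero. Then the girth of G is at most (1/2)·Σ_{u,v ∈ V} f(u,v)²; in particular the girth of G is finite. -/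
open Finset

/-- An integer flow on a simple graph `G`: antisymmetric, supported on adjacent pairs,
and satisfying conservation at every vertex. -/
def IsIntFlow {V : Type*} [Fintype V] (G : SimpleGraph V) (f : V → V → ℤ) : Prop :=
  (∀ u v, f u v = - f v u) ∧ (∀ u v, ¬ G.Adj u v → f u v = 0) ∧
    ∀ u, (∑ v : V, f u v) = 0

namespace IsIntFlow

variable {V : Type*} [Fintype V] {G : SimpleGraph V} {f : V → V → ℤ}

/-- The net flow out of any set of vertices is zero. -/
theorem sum_sum_compl_eq_zero [DecidableEq V] (hf : IsIntFlow G f) (s : Finset V) :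
    ∑ x ∈ s, ∑ y ∈ sᶜ, f x y = 0 := by
  have inner : ∑ x ∈ s, ∑ y ∈ s, f x y = 0 := by
    have h : ∑ x ∈ s, ∑ y ∈ s, f x y = -∑ x ∈ s, ∑ y ∈ s, f x y := by
      conv_lhs => rw [sum_comm]
      simp_rw [← sum_neg_distrib, ← hf.1]
    lia
  have total : ∑ x ∈ s, (∑ y ∈ s, f x y + ∑ y ∈ sᶜ, f x y) = 0 :=
    sum_eq_zero fun x _ ↦ (sum_add_sum_compl s (f x)).trans (hf.2.2 x)
  rwa [sum_add_distrib, inner, zero_add] at total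

/-- An integer flow vanishes on every bridge. -/
theorem eq_zero_of_isBridge (hf : IsIntFlow G f) {u v : V} (h : G.IsBridge s(u, v)) :
    f u v = 0 := by
  classical
  rw [SimpleGraph.isBridge_iff] at h
  let s : Finset V := {x | (G.deleteEdges {s(u, v)}).Reachable u x}
  have hu : u ∈ s := by simp [s]
  have hv : v ∈ sᶜ := by simpa [s] using h
  have cross : ∀ x ∈ s, ∀ y ∈ sᶜ, ¬ (x = u ∧ y = v) → f x y = 0 := by
    intro x hx y hy hxy
    apply hf.2.1
    intro hadj
    have hne : s(x, y) ≠ s(u, v) := by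
      rw [Ne, Sym2.eq_iff]
      rintro (h' | ⟨rfl, rfl⟩)
      · exact hxy h'
      · exact mem_compl.mp hv hx
    simp only [s, mem_compl, mem_filter, mem_univ, true_and] at hx hy
    exact hy (hx.trans (SimpleGraph.Adj.reachable (by simpa using ⟨hadj, by simpa using hne⟩)))
  rw [← hf.sum_sum_compl_eq_zero s, sum_eq_single_of_mem u hu, sum_eq_single_of_mem v hv]
  · exact fun y hy hyv ↦ cross u hu y hy fun h' ↦ hyv h'.2
  · exact fun x hx hxu ↦ sum_eq_zero fun y hy ↦ cross x hx y hy fun h' ↦ hxu h'.1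

/-- The graph whose edges are the pairs carrying nonzero flow. -/
def supportGraph (hf : IsIntFlow G f) : SimpleGraph V where
  Adj u v := f u v ≠ 0
  symm := ⟨fun u v h ↦ by rwa [hf.1 v u, neg_ne_zero]⟩
  loopless := ⟨fun u h ↦ h (hf.2.1 u u (G.irrefl))⟩

theorem supportGraph_le (hf : IsIntFlow G f) : hf.supportGraph ≤ G :=
  fun u v h ↦ by_contra fun hadj ↦ h (hf.2.1 u v hadj)

theorem isIntFlow_supportGraph (hf : IsIntFlow G f) : IsIntFlow hf.supportGraph f :=
  ⟨hf.1, fun _ _ h ↦ not_not.mp h, hf.2.2⟩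

theorem not_isAcyclic_supportGraph (hf : IsIntFlow G f) (hne : f ≠ 0) :
    ¬ hf.supportGraph.IsAcyclic := by
  intro h
  rw [SimpleGraph.isAcyclic_iff_forall_adj_isBridge] at h
  refine hne (funext₂ fun u v ↦ by_contra fun huv ↦ huv ?_)
  exact hf.isIntFlow_supportGraph.eq_zero_of_isBridge (h huv)

theorem two_mul_card_edgeFinset_supportGraph_le (hf : IsIntFlow G f)
    [Fintype hf.supportGraph.edgeSet] :
    ((2 * #hf.supportGraph.edgeFinset : ℕ) : ℤ) ≤ ∑ u, ∑ v, f u v ^ 2 := by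
  classical
  have hcard : 2 * #hf.supportGraph.edgeFinset = #{p : V × V | f p.1 p.2 ≠ 0} := by
    convert hf.supportGraph.two_mul_card_edgeFinset
  rw [hcard, ← Fintype.sum_prod_type', card_filter, Nat.cast_sum]
  refine sum_le_sum fun p _ ↦ ?_
  split_ifs with h
  · exact_mod_cast (sq_pos_of_ne_zero h : 0 < f p.1 p.2 ^ 2)
  · exact sq_nonneg _

end IsIntFlow

/-- If a simple graph `G` on a finite vertex type admits a nonzero integer
flow `f`, then the girth of `G` is at most `(1/2)·∑_{u,v} f(u,v)²`; in particular the girth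
of `G` is finite. -/
theorem egirth_le_of_intFlow {V : Type*} [Fintype V] (G : SimpleGraph V)
    (f : V → V → ℤ) (hf : IsIntFlow G f) (hne : f ≠ 0) :
    G.egirth ≤ (((∑ u : V, ∑ v : V, (f u v) ^ 2).toNat / 2 : ℕ) : ℕ∞) ∧
      G.egirth ≠ ⊤ := by
  classical
  suffices h : G.egirth ≤ (((∑ u : V, ∑ v : V, (f u v) ^ 2).toNat / 2 : ℕ) : ℕ∞) from
    ⟨h, ne_top_of_le_ne_top (ENat.natCast_ne_top _) h⟩
  have hcyc := hf.not_isAcyclic_supportGraph hne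
  simp only [SimpleGraph.IsAcyclic, not_forall, not_not] at hcyc
  obtain ⟨a, w, hw⟩ := hcyc
  calc G.egirth ≤ hf.supportGraph.egirth := SimpleGraph.egirth_anti hf.supportGraph_le
    _ ≤ w.length := SimpleGraph.egirth_le_length hw
    _ ≤ _ := by
      have hlen := hw.isCircuit.isTrail.length_le_card_edgeFinset
      have hcard := hf.two_mul_card_edgeFinset_supportGraph_le
      norm_cast
      lia
end

section
/- Let G be a simple graph on a finite vertex type V whose girth is a finite number g. Then there exists an integer flow f on G, i.e., a function f : V → V → ℤ with f(u,v) = -f(v,u) for all u, v, with f(u,v) = 0 whenever u and v are not adjacent in G, and with Σ_v f(u,v) = 0 for every vertex u, such that f is not identically zero and (1/2)·Σ_{u,v ∈ V} f(u,v)² = g. -/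
open Finset

namespace SimpleGraph

/-- The antisymmetric function sending one unit from `a` to `b`. -/
def unitFlow {V : Type*} [DecidableEq V] (a b x y : V) : ℤ :=
  (if x = a ∧ y = b then 1 else 0) - (if x = b ∧ y = a then 1 else 0)

section unitFlow

variable {V : Type*} [DecidableEq V]

lemma unitFlow_antisymm (a b x y : V) : unitFlow a b x y = -unitFlow a b y x := by
  simp only [unitFlow, and_comm, neg_sub]

lemma unitFlow_eq_zero {a b x y : V} (h : s(x, y) ≠ s(a, b)) : unitFlow a b x y = 0 := by
  rw [Ne, Sym2.eq_iff, not_or] at h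
  simp [unitFlow, h.1, h.2]

lemma sum_unitFlow [Fintype V] (a b x : V) :
    ∑ y, unitFlow a b x y = (if x = a then 1 else 0) - (if x = b then 1 else 0) := by
  simp [unitFlow, ite_and]

lemma sum_sq_unitFlow [Fintype V] {a b : V} (h : a ≠ b) :
    ∑ x, ∑ y, unitFlow a b x y ^ 2 = 2 := by
  have key (x y : V) : unitFlow a b x y ^ 2 =
      (if x = a then if y = b then 1 else 0 else 0) +
        (if x = b then if y = a then 1 else 0 else 0) := by
    grind [unitFlow]
  simp [key, sum_add_distrib]

end unitFlow

namespace Walk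

variable {V : Type*} [DecidableEq V] {G : SimpleGraph V}

/-- The net number of times a walk traverses each ordered pair of vertices. -/
def flow {a b : V} : G.Walk a b → V → V → ℤ
  | nil, _, _ => 0
  | cons (v := c) _ p, x, y => unitFlow a c x y + p.flow x y

lemma flow_antisymm {a b : V} (p : G.Walk a b) (x y : V) : p.flow x y = -p.flow y x := by
  induction p with
  | nil => simp [flow]
  | cons h p ih => rw [flow, flow, ih, unitFlow_antisymm, neg_add]

lemma flow_eq_zero {a b : V} (p : G.Walk a b) {x y : V} (hxy : s(x, y) ∉ p.edges) :
    p.flow x y = 0 := by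
  induction p with
  | nil => rfl
  | cons h p ih =>
    rw [edges_cons, List.mem_cons, not_or] at hxy
    rw [flow, unitFlow_eq_zero hxy.1, ih hxy.2, add_zero]

lemma sum_flow [Fintype V] {a b : V} (p : G.Walk a b) (x : V) :
    ∑ y, p.flow x y = (if x = a then 1 else 0) - (if x = b then 1 else 0) := by
  induction p with
  | nil => simp [flow]
  | cons h p ih =>
    simp only [flow, sum_add_distrib, sum_unitFlow, ih]
    ring

lemma IsTrail.sum_sq_flow [Fintype V] {a b : V} {p : G.Walk a b} (hp : p.IsTrail) :
    ∑ x, ∑ y, p.flow x y ^ 2 = 2 * (p.length : ℤ) := by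
  induction p with
  | nil => simp [flow]
  | @cons a c _ h p ih =>
    rw [isTrail_cons] at hp
    have key (x y : V) :
        (cons h p).flow x y ^ 2 = unitFlow a c x y ^ 2 + p.flow x y ^ 2 := by
      by_cases hxy : s(x, y) = s(a, c)
      · simp [flow, p.flow_eq_zero (hxy ▸ hp.2)]
      · simp [flow, unitFlow_eq_zero hxy]
    simp only [key, sum_add_distrib, sum_sq_unitFlow h.ne, ih hp.1, length_cons]
    push_cast
    ring

lemma isIntFlow_flow [Fintype V] {a : V} (p : G.Walk a a) : IsIntFlow G p.flow :=
  ⟨p.flow_antisymm, fun _ _ h ↦ p.flow_eq_zero fun hp ↦ h (p.adj_of_mem_edges hp),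
    fun u ↦ by rw [sum_flow, sub_self]⟩

end Walk

end SimpleGraph

/-- If a simple graph `G` on a finite vertex type has finite girth `g`, then
there is a nonzero integer flow `f` on `G` with `(1/2)·∑_{u,v} f(u,v)² = g`. -/
theorem exists_intFlow_of_egirth {V : Type*} [Fintype V] (G : SimpleGraph V)
    (g : ℕ) (hg : G.egirth = (g : ℕ∞)) :
    ∃ f : V → V → ℤ, IsIntFlow G f ∧ f ≠ 0 ∧
      (∑ u : V, ∑ v : V, (f u v) ^ 2) = 2 * (g : ℤ) := by
  classical
  have hG : ¬ G.IsAcyclic := by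
    rw [← SimpleGraph.egirth_eq_top, hg]
    exact ENat.natCast_ne_top g
  obtain ⟨a, w, hw, hwl⟩ := SimpleGraph.exists_egirth_eq_length.mpr hG
  obtain rfl : g = w.length := by exact_mod_cast hg.symm.trans hwl
  have hsum := hw.isTrail.sum_sq_flow
  refine ⟨w.flow, w.isIntFlow_flow, fun h0 ↦ ?_, hsum⟩
  have := hw.three_le_length
  simp only [h0, Pi.zero_apply, ne_eq, OfNat.ofNat_ne_zero, not_false_eq_true, zero_pow,
    sum_const_zero] at hsum
  lia
end

section
/- Let G be a simple graph on a finite vertex type V and let f : V → V → ℤ be a nonzero integer flow on G, i.e., f(u,v) = -f(v,u) for all u, v; f(u,v) = 0 whenever u and v are not adjacent in G; Σ_v f(u,v) = 0 for every vertex u; and f is not identically zero. Then G contains a cycle every edge {u,v} of which satisfies f(u,v) ≠ 0; that is, the support of f contains the edge set of a cycle of G. -/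
open Finset

/-- The total of an antisymmetric function over a square vanishes. -/
theorem sum_sum_eq_zero_of_antisymm {V : Type*} {f : V → V → ℤ}
    (hf : ∀ u v, f u v = -f v u) (S : Finset V) : ∑ u ∈ S, ∑ v ∈ S, f u v = 0 := by
  have h : ∑ u ∈ S, ∑ v ∈ S, f u v = -∑ u ∈ S, ∑ v ∈ S, f u v := by
    conv_lhs => rw [Finset.sum_comm]
    simp only [← Finset.sum_neg_distrib]
    exact Finset.sum_congr rfl fun u _ => Finset.sum_congr rfl fun v _ => hf v u
  omega

/-- The net flow of an integer flow across any vertex cut vanishes. -/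
theorem IsIntFlow.sum_cut_eq_zero {V : Type*} [Fintype V] [DecidableEq V] {G : SimpleGraph V}
    {f : V → V → ℤ} (hf : IsIntFlow G f) (S : Finset V) :
    ∑ u ∈ S, ∑ v ∈ Sᶜ, f u v = 0 := by
  have h : ∑ u ∈ S, (∑ v ∈ S, f u v + ∑ v ∈ Sᶜ, f u v) = 0 :=
    Finset.sum_eq_zero fun u _ => by rw [Finset.sum_add_sum_compl, hf.2.2 u]
  rwa [Finset.sum_add_distrib, sum_sum_eq_zero_of_antisymm hf.1, zero_add] at h

/-- The graph of pairs carrying nonzero flow. -/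
def IsIntFlow.supportGraph_s5 {V : Type*} [Fintype V] {G : SimpleGraph V} {f : V → V → ℤ}
    (hf : IsIntFlow G f) : SimpleGraph V where
  Adj u v := f u v ≠ 0
  symm := ⟨fun u v h => by rw [hf.1 v u]; exact neg_ne_zero.mpr h⟩
  loopless := ⟨fun u h => h (hf.2.1 u u G.irrefl)⟩

theorem IsIntFlow.supportGraph_le_s5 {V : Type*} [Fintype V] {G : SimpleGraph V} {f : V → V → ℤ}
    (hf : IsIntFlow G f) : hf.supportGraph_s5 ≤ G :=
  fun u v h => by_contra fun hG => h (hf.2.1 u v hG)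

/-- No edge carrying nonzero flow is a bridge of the support graph. -/
theorem IsIntFlow.not_isBridge {V : Type*} [Fintype V] {G : SimpleGraph V} {f : V → V → ℤ}
    (hf : IsIntFlow G f) {a b : V} (hab : f a b ≠ 0) : ¬ hf.supportGraph_s5.IsBridge s(a, b) := by
  classical
  intro hbridge
  rw [SimpleGraph.isBridge_iff] at hbridge
  set H := hf.supportGraph_s5.deleteEdges {s(a, b)}
  let S : Finset V := {x | H.Reachable a x}
  have ha : a ∈ S := by simp [S]
  have hb : b ∈ Sᶜ := by simpa [S] using hbridge
  have hcross : ∀ u ∈ S, ∀ v ∈ Sᶜ, f u v ≠ 0 → u = a ∧ v = b := by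
    intro u hu v hv huv
    have hadj : ¬ H.Adj u v := fun h => by
      simp only [S, Finset.mem_compl, Finset.mem_filter_univ] at hu hv
      exact hv (hu.trans h.reachable)
    have he : s(u, v) = s(a, b) := by
      by_contra he
      exact hadj (SimpleGraph.deleteEdges_adj.mpr ⟨huv, he⟩)
    rcases Sym2.eq_iff.mp he with h | ⟨rfl, rfl⟩
    · exact h
    · exact absurd hu (Finset.mem_compl.mp hb)
  refine hab ?_
  rw [← hf.sum_cut_eq_zero S, Finset.sum_eq_single_of_mem a ha, Finset.sum_eq_single_of_mem b hb]
  · exact fun v hv hvb => by_contra fun h => hvb (hcross a ha v hv h).2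
  · exact fun u hu hua => Finset.sum_eq_zero fun v hv =>
      by_contra fun h => hua (hcross u hu v hv h).1

/-- The support of a nonzero integer flow on a simple graph `G` contains
the edge set of a cycle of `G`. -/
theorem intFlow_support_contains_cycle {V : Type*} [Fintype V] (G : SimpleGraph V)
    (f : V → V → ℤ) (hf : IsIntFlow G f) (hne : f ≠ 0) :
    ∃ (a : V) (c : G.Walk a a), c.IsCycle ∧
      ∀ u v : V, s(u, v) ∈ c.edges → f u v ≠ 0 := by
  obtain ⟨a, ha⟩ := Function.ne_iff.mp hne
  obtain ⟨b, hab⟩ := Function.ne_iff.mp ha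
  have hcyc : ¬ hf.supportGraph_s5.IsAcyclic := fun h =>
    hf.not_isBridge hab (SimpleGraph.isAcyclic_iff_forall_isBridge.mp h
      (show s(a, b) ∈ hf.supportGraph_s5.edgeSet from hab))
  simp only [SimpleGraph.IsAcyclic, not_forall, not_not] at hcyc
  obtain ⟨x, c, hc⟩ := hcyc
  refine ⟨x, c.mapLe hf.supportGraph_le_s5, hc.mapLe _, fun u v huv => ?_⟩
  rw [SimpleGraph.Walk.edges_mapLe_eq_edges] at huv
  exact c.adj_of_mem_edges huv
end
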